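/- If R is a unique factorization domain and a is a prime element of R, then aC is a prime ideal of C, the ring C[1/a] is a Noetherian unique factorization domain, and C itself is a unique factorization domain. If in addition R is a regular ring, then C[1/a] is a regular Noetherian unique factorization domain. -/

import Mathlib

set_option synthInstance.maxHeartbeats 1000000
set_option maxHeartbeats 1000000
noncomputable section
namespace HRWGen

variable (R : Type) [CommRing R] [IsDomain R] [IsNoetherianRing R] (a : R)

/-- `R* `, the `(a)`-adic completion of `R`. -/
abbrev RstarG := AdicCompletion (Ideal.span {a}) R

/-- The image of `a` in `R*`. -/
def aS : RstarG R a := algebraMap R (RstarG R a) a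

variable {h : ℕ} (cc : Fin h → ℕ → R) (tau : Fin h → RstarG R a)
  (taue : Fin h → ℕ → RstarG R a)

/-- `U_r = R[τ_{1r}, …, τ_{hr}]`. -/
def Ur (r : ℕ) : Subalgebra R (RstarG R a) :=
  Algebra.adjoin R (Set.range fun i => taue i r)

/-- `C_r = (1 + aU_r)^{-1} U_r`, realized inside `R*` by adjoining the inverses of the
elements `1 + a·u`, `u ∈ U_r` (all of which are units of the `(a)`-adically complete
ring `R*`). -/
def Cr (r : ℕ) : Subalgebra R (RstarG R a) :=
  Algebra.adjoin R ((Set.range fun i => taue i r) ∪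
    {w | ∃ u ∈ Algebra.adjoin R (Set.range fun i => taue i r),
      w * (1 + aS R a * u) = 1})

/-- `U = ∪_r U_r`. -/
def UU : Subalgebra R (RstarG R a) := ⨆ r, Ur R a taue r

/-- `C = ∪_r C_r`. -/
def CC : Subalgebra R (RstarG R a) := ⨆ r, Cr R a taue r

/-- The hypotheses: `a` is a nonzero nonunit, `h ≥ 1`, the `τ_i` are algebraically
independent over `R` (equivalently over `K`), `τ_{i0} = τ_i`, and the endpieces satisfy
`a^r τ_{ir} = τ_i - Σ_{j=1}^r c_{ij} a^j` (in particular `τ_i = Σ_{j≥1} c_{ij} a^j ∈ aR[[a]]`). -/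
structure SetupG (cc : Fin h → ℕ → R) (tau : Fin h → RstarG R a)
    (taue : Fin h → ℕ → RstarG R a) : Prop where
  hh : 0 < h
  ha0 : a ≠ 0
  hau : ¬ IsUnit a
  hind : AlgebraicIndependent R tau
  he0 : ∀ i, taue i 0 = tau i
  hrec : ∀ i r, aS R a ^ r * taue i r =
    tau i - algebraMap R (RstarG R a) (∑ j ∈ Finset.Icc 1 r, cc i j * a ^ j)

/-- A Noetherian local ring is regular if its maximal ideal is generated by
(Krull dimension)-many elements. -/
def IsRegularLocal (S : Type*) [CommRing S] : Prop :=
  IsNoetherianRing S ∧ ∃ hl : IsLocalRing S,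
    haveI := hl
    ∃ s : Finset S, Ideal.span (s : Set S) = IsLocalRing.maximalIdeal S ∧
      (s.card : WithBot (WithTop ℕ)) = ringKrullDim S

/-- A ring is regular if all of its localizations at primes are regular local rings. -/
def IsRegularRing (S : Type) [CommRing S] : Prop :=
  ∀ (P : Ideal S) (hP : P.IsPrime), ∀ (D : Type) [CommRing D] [Algebra S D],
    (haveI := hP; IsLocalization.AtPrime D P) → IsRegularLocal D

section Regular

theorem IsRegularLocal.isRegularLocalRing {S : Type*} [CommRing S] (hS : IsRegularLocal S) :
    IsRegularLocalRing S := by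
  obtain ⟨hn, hl, s, hs, hc⟩ := hS
  refine IsRegularLocalRing.of_spanFinrank_maximalIdeal_le S ?_
  rw [← hc, ← hs]
  have : (Ideal.span (s : Set S)).spanFinrank ≤ s.card := by
    simpa using Submodule.spanFinrank_span_le_ncard_of_finite (R := S) s.finite_toSet
  exact (Nat.cast_le (α := WithBot ℕ∞)).mpr this

theorem isRegularLocal_of_isRegularLocalRing {S : Type*} [CommRing S] [IsRegularLocalRing S] :
    IsRegularLocal S := by
  refine ⟨inferInstance, inferInstance, ?_⟩
  have hfg : (IsLocalRing.maximalIdeal S).FG := IsNoetherian.noetherian _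
  have hfin := Submodule.FG.finite_generators hfg
  refine ⟨hfin.toFinset, ?_, ?_⟩
  · rw [Set.Finite.coe_toFinset]
    exact Submodule.span_generators _
  · rw [← Set.ncard_eq_toFinset_card _ hfin, Submodule.FG.generators_ncard hfg]
    exact IsRegularLocalRing.spanFinrank_maximalIdeal

theorem IsRegularRing.toRegularRing {S : Type} [CommRing S] [IsNoetherianRing S]
    (hS : IsRegularRing S) : _root_.IsRegularRing S :=
  isRegularRing_iff.mpr fun p hp =>
    (hS p hp (Localization.AtPrime p) inferInstance).isRegularLocalRing

theorem isRegularRing_of_isLocalization {A L : Type} [CommRing A] [CommRing L] [Algebra A L]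
    [_root_.IsRegularRing A] (M : Submonoid A) [IsLocalization M L] : IsRegularRing L := by
  intro P hP D _ _ hD
  let _ : Algebra A D := ((algebraMap L D).comp (algebraMap A L)).toAlgebra
  have : IsScalarTower A L D := IsScalarTower.of_algebraMap_eq fun _ => rfl
  have : IsLocalization.AtPrime D (P.comap (algebraMap A L)) :=
    IsLocalization.isLocalization_isLocalization_atPrime_isLocalization M D P
  have := IsRegularLocalRing.of_ringEquiv
    (IsLocalization.algEquiv (P.comap (algebraMap A L)).primeCompl
      (Localization.AtPrime (P.comap (algebraMap A L))) D).toRingEquiv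
  exact isRegularLocal_of_isRegularLocalRing

end Regular

section Nagata

variable {C : Type*} [CommRing C] {w : C}

theorem exists_eq_pow_mul_not_dvd (hfin : ∀ x : C, x ≠ 0 → ∃ n, ¬ w ^ n ∣ x) {x : C}
    (hx : x ≠ 0) : ∃ n y, x = w ^ n * y ∧ ¬ w ∣ y := by
  obtain ⟨y, hy⟩ := (FiniteMultiplicity.exists_eq_pow_mul_and_not_dvd
    (a := w) (b := x) (by
      obtain ⟨n, hn⟩ := hfin x hx
      exact ⟨n, fun h => hn ((pow_dvd_pow w n.le_succ).trans h)⟩))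
  exact ⟨_, y, hy⟩

theorem isDomain_of_prime_of_separated (hw : Prime w) (hreg : w ∈ nonZeroDivisors C)
    (hfin : ∀ x : C, x ≠ 0 → ∃ n, ¬ w ^ n ∣ x) : IsDomain C := by
  have : Nontrivial C := ⟨w, 0, hw.ne_zero⟩
  have : NoZeroDivisors C := by
    refine ⟨fun {x y} hxy => ?_⟩
    by_contra! hne
    obtain ⟨n, x', rfl, hx'⟩ := exists_eq_pow_mul_not_dvd hfin hne.1
    obtain ⟨m, y', rfl, hy'⟩ := exists_eq_pow_mul_not_dvd hfin hne.2
    have h0 : (x' * y') * w ^ (n + m) = 0 := by rw [← hxy]; ring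
    have h1 := (mem_nonZeroDivisors_iff_right.mp (pow_mem hreg (n + m))) _ h0
    rcases hw.dvd_or_dvd (h1 ▸ dvd_zero w : w ∣ x' * y') with h | h
    exacts [hx' h, hy' h]
  exact NoZeroDivisors.to_isDomain C

theorem uniqueFactorizationMonoid_of_away [IsDomain C] (hw : Prime w)
    (hfin : ∀ x : C, x ≠ 0 → ∃ n, ¬ w ^ n ∣ x) (L : Type*) [CommRing L] [Algebra C L]
    [IsLocalization.Away w L] [IsDomain L] [UniqueFactorizationMonoid L] :
    UniqueFactorizationMonoid C := by
  have hM : Submonoid.powers w ≤ nonZeroDivisors C := powers_le_nonZeroDivisors_of_noZeroDivisors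
    hw.ne_zero
  have hinj : Function.Injective (algebraMap C L) := IsLocalization.injective L hM
  have hwu : ∀ n, IsUnit (algebraMap C L (w ^ n)) := fun n =>
    IsLocalization.map_units L (⟨w ^ n, n, rfl⟩ : Submonoid.powers w)
  refine UniqueFactorizationMonoid.iff_exists_prime_mem_of_isPrime.mpr fun P hP0 hP => ?_
  by_cases hwP : w ∈ P
  · exact ⟨w, hwP, hw⟩
  have hdisj : Disjoint (Submonoid.powers w : Set C) (P : Set C) := by
    rw [Set.disjoint_left]
    rintro _ ⟨n, rfl⟩ h
    exact hwP (hP.mem_of_pow_mem n h)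
  have hPL : (P.map (algebraMap C L)).IsPrime :=
    IsLocalization.isPrime_of_isPrime_disjoint (Submonoid.powers w) L P hP hdisj
  have hcomap : (P.map (algebraMap C L)).comap (algebraMap C L) = P :=
    IsLocalization.under_map_of_isPrime_disjoint (Submonoid.powers w) L hP hdisj
  have hPL0 : P.map (algebraMap C L) ≠ ⊥ := fun h0 =>
    hP0 ((Ideal.map_eq_bot_iff_of_injective hinj).mp h0)
  obtain ⟨q, hqP, hq⟩ := hPL.exists_mem_prime_of_ne_bot hPL0
  obtain ⟨⟨x, ⟨_, k, rfl⟩⟩, hx⟩ := IsLocalization.surj (Submonoid.powers w) q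
  have hx0 : x ≠ 0 := by
    rintro rfl
    simp only [map_zero] at hx
    rcases mul_eq_zero.mp hx with h | h
    exacts [hq.ne_zero h, (hwu k).ne_zero h]
  obtain ⟨n, p, rfl, hp⟩ := exists_eq_pow_mul_not_dvd hfin hx0
  have hassoc : Associated q (algebraMap C L p) := by
    have h1 : Associated (q * algebraMap C L (w ^ k)) q := associated_mul_unit_left _ _ (hwu k)
    have h2 : Associated (algebraMap C L (w ^ n * p)) (algebraMap C L p) := by
      rw [map_mul]; exact associated_unit_mul_left _ _ (hwu n)
    exact h1.symm.trans ((Associated.of_eq hx).trans h2)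
  have hpL : Prime (algebraMap C L p) := hassoc.prime hq
  have hdvd : ∀ x, algebraMap C L p ∣ algebraMap C L x → p ∣ x := by
    rintro x ⟨z, hz⟩
    obtain ⟨⟨y, ⟨_, m, rfl⟩⟩, hy⟩ := IsLocalization.surj (Submonoid.powers w) z
    have h1 : w ^ m * x = p * y := hinj (by
      simp only [map_mul] at hy ⊢
      rw [hz, ← hy]; ring)
    have h2 : w ^ m ∣ y := (hw.pow_dvd_of_dvd_mul_left m hp ⟨x, h1.symm⟩)
    obtain ⟨t, rfl⟩ := h2
    exact ⟨t, mul_left_cancel₀ (pow_ne_zero m hw.ne_zero) (by rw [h1]; ring)⟩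
  refine ⟨p, ?_, ?_, ?_, ?_⟩
  · rw [← hcomap, Ideal.mem_comap]
    obtain ⟨u, hu⟩ := hassoc
    rw [← hu]
    exact Ideal.mul_mem_right _ _ hqP
  · rintro rfl
    exact hpL.ne_zero (map_zero _)
  · exact fun h => hpL.not_isUnit (h.map _)
  · intro x y hxy
    have := hpL.dvd_or_dvd (a := algebraMap C L x) (b := algebraMap C L y)
      (by rw [← map_mul]; exact map_dvd _ hxy)
    exact this.imp (hdvd x) (hdvd y)

end Nagata

set_option linter.unusedSectionVars false

section Completion

variable {R a}

theorem evalₐ_aS_pow (n : ℕ) : AdicCompletion.evalₐ (Ideal.span {a}) n (aS R a ^ n) = 0 := by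
  rw [aS, ← map_pow, AlgHom.commutes, Ideal.Quotient.algebraMap_eq,
    Ideal.Quotient.eq_zero_iff_mem]
  exact Ideal.pow_mem_pow (Ideal.mem_span_singleton_self a) n

theorem evalₐ_algebraMap_eq_zero_iff (n : ℕ) (r : R) :
    AdicCompletion.evalₐ (Ideal.span {a}) n (algebraMap R (RstarG R a) r) = 0 ↔ a ^ n ∣ r := by
  rw [AlgHom.commutes, Ideal.Quotient.algebraMap_eq,
    Ideal.Quotient.eq_zero_iff_mem, Ideal.span_singleton_pow, Ideal.mem_span_singleton]

theorem aS_mem_nonZeroDivisors (ha : a ≠ 0) : aS R a ∈ nonZeroDivisors (RstarG R a) := by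
  refine mem_nonZeroDivisors_iff_right.mpr fun x hx => ?_
  obtain ⟨f, rfl⟩ := AdicCompletion.mk_surjective (Ideal.span {a}) R x
  refine AdicCompletion.ext_evalₐ fun n => ?_
  have h1 := congrArg (AdicCompletion.evalₐ (Ideal.span {a}) (n + 1)) hx
  rw [map_mul, aS, AlgHom.commutes, AdicCompletion.evalₐ_mk, map_zero,
    Ideal.Quotient.algebraMap_eq, ← map_mul, Ideal.Quotient.eq_zero_iff_mem,
    Ideal.span_singleton_pow, Ideal.mem_span_singleton, pow_succ] at h1
  have h2 : a ^ n ∣ f.val (n + 1) := (mul_dvd_mul_iff_right ha).mp h1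
  rw [map_zero, AdicCompletion.evalₐ_mk, Ideal.Quotient.eq_zero_iff_mem]
  have h3 := f.property n.le_succ
  rw [smul_eq_mul, Ideal.mul_top] at h3
  have h4 := (SModEq.sub_mem.mp h3)
  rw [Ideal.span_singleton_pow, Ideal.mem_span_singleton] at h4 ⊢
  simpa using dvd_add h4 h2

end Completion

section Main

variable {R a} {cc tau taue}

theorem SetupG.taue_eq (hs : SetupG R a cc tau taue) (i : Fin h) (r : ℕ) :
    taue i r = aS R a * (algebraMap R _ (cc i (r + 1)) + taue i (r + 1)) := by
  have hreg := pow_mem (aS_mem_nonZeroDivisors hs.ha0) r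
  have h1 := hs.hrec i r
  have h2 := hs.hrec i (r + 1)
  rw [Finset.sum_Icc_succ_top (by omega), map_add, map_mul, map_pow] at h2
  rw [← mul_cancel_left_mem_nonZeroDivisors hreg, h1]
  change _ = _ - (_ + _ * aS R a ^ (r + 1)) at h2
  linear_combination -h2

theorem taue_mem_CC (i : Fin h) (r : ℕ) : taue i r ∈ CC R a taue :=
  le_iSup (Cr R a taue) r (Algebra.subset_adjoin (Or.inl ⟨i, rfl⟩))

theorem Ur_le_Cr (r : ℕ) : Ur R a taue r ≤ Cr R a taue r :=
  Algebra.adjoin_mono Set.subset_union_left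

theorem Cr_le_CC (r : ℕ) : Cr R a taue r ≤ CC R a taue := le_iSup (Cr R a taue) r

theorem aS_mem (S : Subalgebra R (RstarG R a)) : aS R a ∈ S := S.algebraMap_mem a

/-- To check that a subalgebra contains `C`, it suffices to check the generators of each `C_r`. -/
theorem CC_le {T : Subalgebra R (RstarG R a)} (h1 : ∀ i r, taue i r ∈ T)
    (h2 : ∀ r, ∀ u ∈ Ur R a taue r, ∀ w ∈ CC R a taue, w * (1 + aS R a * u) = 1 → w ∈ T) :
    CC R a taue ≤ T := by
  refine iSup_le fun r => Algebra.adjoin_le ?_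
  rintro w (⟨i, rfl⟩ | ⟨u, hu, hw⟩)
  · exact h1 i r
  · exact h2 r u hu w (Cr_le_CC r (Algebra.subset_adjoin (Or.inr ⟨u, hu, hw⟩))) hw

/-- The subalgebra `R + aC` of `R*`. -/
def baseAdd (S : Subalgebra R (RstarG R a)) : Subalgebra R (RstarG R a) where
  carrier := {c | ∃ r : R, ∃ d ∈ S, c = algebraMap R _ r + aS R a * d}
  mul_mem' := by
    rintro _ _ ⟨r, d, hd, rfl⟩ ⟨r', d', hd', rfl⟩
    refine ⟨r * r', algebraMap R _ r * d' + d * (algebraMap R _ r' + aS R a * d'), ?_, ?_⟩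
    · exact add_mem (mul_mem (S.algebraMap_mem r) hd')
        (mul_mem hd (add_mem (S.algebraMap_mem r') (mul_mem (aS_mem S) hd')))
    · rw [map_mul]; ring
  add_mem' := by
    rintro _ _ ⟨r, d, hd, rfl⟩ ⟨r', d', hd', rfl⟩
    exact ⟨r + r', d + d', add_mem hd hd', by rw [map_add]; ring⟩
  algebraMap_mem' r := ⟨r, 0, zero_mem S, by ring⟩

theorem SetupG.CC_le_baseAdd (hs : SetupG R a cc tau taue) :
    CC R a taue ≤ baseAdd (CC R a taue) := by
  refine CC_le (fun i r => ?_) fun r u hu w hwC hw => ?_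
  · refine ⟨0, algebraMap R _ (cc i (r + 1)) + taue i (r + 1), ?_, ?_⟩
    · exact add_mem (Subalgebra.algebraMap_mem _ _) (taue_mem_CC i (r + 1))
    · rw [map_zero, zero_add]; exact hs.taue_eq i r
  · refine ⟨1, -(w * u), neg_mem (mul_mem hwC (Cr_le_CC r (Ur_le_Cr r hu))), ?_⟩
    rw [map_one]; linear_combination hw

/-- The subalgebra of fractions `p(τ) / s(τ)` in `R*` whose denominator divides a power of `a`
in `S`. -/
def fracSubalgebra (S : Subalgebra R (RstarG R a)) (tau : Fin h → RstarG R a) :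
    Subalgebra R (RstarG R a) where
  carrier := {c | ∃ p s : MvPolynomial (Fin h) R, ∃ d ∈ S, ∃ n : ℕ,
    c * MvPolynomial.aeval tau s = MvPolynomial.aeval tau p ∧
      d * MvPolynomial.aeval tau s = aS R a ^ n}
  mul_mem' := by
    rintro c c' ⟨p, s, d, hd, n, h1, h2⟩ ⟨p', s', d', hd', n', h1', h2'⟩
    refine ⟨p * p', s * s', d * d', mul_mem hd hd', n + n', ?_, ?_⟩
    · rw [map_mul, map_mul, ← h1, ← h1']; ring
    · rw [map_mul, pow_add, ← h2, ← h2']; ring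
  add_mem' := by
    rintro c c' ⟨p, s, d, hd, n, h1, h2⟩ ⟨p', s', d', hd', n', h1', h2'⟩
    refine ⟨p * s' + p' * s, s * s', d * d', mul_mem hd hd', n + n', ?_, ?_⟩
    · rw [map_mul, map_add, map_mul, map_mul, ← h1, ← h1']; ring
    · rw [map_mul, pow_add, ← h2, ← h2']; ring
  algebraMap_mem' r := ⟨MvPolynomial.C r, 1, 1, one_mem S, 0, by simp, by simp⟩

/-- The subalgebra of those elements of `R*` which a power of `a` multiplies into `R[τ]`. -/
def powFracSubalgebra (tau : Fin h → RstarG R a) :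
    Subalgebra R (RstarG R a) where
  carrier := {c | ∃ p : MvPolynomial (Fin h) R, ∃ n : ℕ,
    c * aS R a ^ n = MvPolynomial.aeval tau p}
  mul_mem' := by
    rintro c c' ⟨p, n, h1⟩ ⟨p', n', h1'⟩
    exact ⟨p * p', n + n', by rw [map_mul, pow_add, ← h1, ← h1']; ring⟩
  add_mem' := by
    rintro c c' ⟨p, n, h1⟩ ⟨p', n', h1'⟩
    refine ⟨p * MvPolynomial.C (a ^ n') + p' * MvPolynomial.C (a ^ n), n + n', ?_⟩
    simp only [map_mul, map_add, MvPolynomial.aeval_C, map_pow, ← h1, ← h1']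
    change _ = _ * aS R a ^ _ + _ * aS R a ^ _
    ring
  algebraMap_mem' r := ⟨MvPolynomial.C r, 0, by simp⟩

theorem SetupG.taue_mem_powFracSubalgebra (hs : SetupG R a cc tau taue) (i : Fin h) (r : ℕ) :
    taue i r ∈ powFracSubalgebra tau := by
  refine ⟨MvPolynomial.X i - MvPolynomial.C (∑ j ∈ Finset.Icc 1 r, cc i j * a ^ j), r, ?_⟩
  rw [map_sub, MvPolynomial.aeval_X, MvPolynomial.aeval_C, ← hs.hrec i r, mul_comm]

theorem SetupG.CC_le_fracSubalgebra (hs : SetupG R a cc tau taue) :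
    CC R a taue ≤ fracSubalgebra (CC R a taue) tau := by
  have haC : ∀ n, MvPolynomial.aeval tau (MvPolynomial.C (a ^ n)) = aS R a ^ n := fun n => by
    rw [MvPolynomial.aeval_C, map_pow]; rfl
  refine CC_le (fun i r => ?_) fun r u hu w hwC hw => ?_
  · obtain ⟨p, n, hp⟩ := hs.taue_mem_powFracSubalgebra i r
    exact ⟨p, MvPolynomial.C (a ^ n), 1, one_mem _, n, by rw [haC, hp], by rw [haC, one_mul]⟩
  · have hu' : u ∈ powFracSubalgebra tau :=
      Algebra.adjoin_le (by rintro _ ⟨i, rfl⟩; exact hs.taue_mem_powFracSubalgebra i r) hu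
    obtain ⟨p, n, hp⟩ := hu'
    have key : MvPolynomial.aeval tau (MvPolynomial.C (a ^ n) + MvPolynomial.C (a ^ 1) * p) =
        (1 + aS R a * u) * aS R a ^ n := by
      rw [map_add, map_mul, haC, haC, ← hp]; ring
    refine ⟨MvPolynomial.C (a ^ n), MvPolynomial.C (a ^ n) + MvPolynomial.C (a ^ 1) * p, w, hwC, n, ?_, ?_⟩
    · rw [key, haC, ← mul_assoc, hw, one_mul]
    · rw [key, ← mul_assoc, hw, one_mul]

theorem tau_mem_CC (hs : SetupG R a cc tau taue) (i : Fin h) : tau i ∈ CC R a taue :=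
  hs.he0 i ▸ taue_mem_CC i 0

theorem SetupG.aeval_mem_CC (hs : SetupG R a cc tau taue) (p : MvPolynomial (Fin h) R) :
    MvPolynomial.aeval tau p ∈ CC R a taue := by
  have h1 : (MvPolynomial.aeval (R := R) tau).range ≤ CC R a taue := by
    rw [← Algebra.adjoin_range_eq_range_aeval]
    exact Algebra.adjoin_le (by rintro _ ⟨i, rfl⟩; exact tau_mem_CC hs i)
  exact h1 ⟨p, rfl⟩

/-- The evaluation map `R[X] → C` at `τ`. -/
def SetupG.evalCC (hs : SetupG R a cc tau taue) :
    MvPolynomial (Fin h) R →ₐ[R] CC R a taue :=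
  (MvPolynomial.aeval tau).codRestrict _ hs.aeval_mem_CC

theorem SetupG.evalCC_injective (hs : SetupG R a cc tau taue) :
    Function.Injective hs.evalCC := fun _ _ h =>
  hs.hind (congrArg Subtype.val h)

variable {w : CC R a taue}

theorem SetupG.mem_nonZeroDivisors (hs : SetupG R a cc tau taue)
    (hw : (w : RstarG R a) = aS R a) : w ∈ nonZeroDivisors (CC R a taue) := by
  refine mem_nonZeroDivisors_iff_right.mpr fun x hx => Subtype.ext ?_
  refine mem_nonZeroDivisors_iff_right.mp (aS_mem_nonZeroDivisors hs.ha0) _ ?_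
  rw [← hw]; exact congrArg Subtype.val hx

theorem SetupG.dvd_iff (hs : SetupG R a cc tau taue) (hw : (w : RstarG R a) = aS R a)
    (x : CC R a taue) :
    w ∣ x ↔ AdicCompletion.evalₐ (Ideal.span {a}) 1 (x : RstarG R a) = 0 := by
  have ha : AdicCompletion.evalₐ (Ideal.span {a}) 1 (aS R a) = 0 := by
    simpa using evalₐ_aS_pow (a := a) 1
  constructor
  · rintro ⟨y, rfl⟩
    rw [MulMemClass.coe_mul, hw, map_mul, ha, zero_mul]
  · intro hx
    obtain ⟨r, d, hd, hxr⟩ := hs.CC_le_baseAdd x.2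
    rw [hxr, map_add, map_mul, ha, zero_mul, add_zero, evalₐ_algebraMap_eq_zero_iff,
      pow_one] at hx
    obtain ⟨t, rfl⟩ := hx
    refine ⟨algebraMap R _ t + ⟨d, hd⟩, Subtype.ext ?_⟩
    rw [hxr, MulMemClass.coe_mul, hw, map_mul, AddMemClass.coe_add, mul_add]
    rfl

theorem SetupG.prime (hs : SetupG R a cc tau taue) (hap : Prime a)
    (hw : (w : RstarG R a) = aS R a) : Prime w := by
  have hI : (Ideal.span {a} ^ 1).IsPrime := by
    rw [pow_one]
    exact (Ideal.span_singleton_prime hap.ne_zero).mpr hap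
  refine ⟨?_, ?_, ?_⟩
  · rintro rfl
    have h0 := (evalₐ_algebraMap_eq_zero_iff (a := a) 2 a).mp (by
      change AdicCompletion.evalₐ _ 2 (aS R a) = 0
      rw [← hw]; exact map_zero _)
    rw [pow_two] at h0
    have : a * a ∣ a * 1 := by rwa [mul_one]
    exact hap.not_isUnit (isUnit_of_dvd_one ((mul_dvd_mul_iff_left hap.ne_zero).mp this))
  · intro hu
    have h1 := (hs.dvd_iff hw 1).mp hu.dvd
    rw [OneMemClass.coe_one, map_one] at h1
    have := Ideal.Quotient.nontrivial_iff.mpr hI.ne_top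
    exact one_ne_zero h1
  · intro x y hxy
    rw [hs.dvd_iff hw, MulMemClass.coe_mul, map_mul] at hxy
    rw [hs.dvd_iff hw, hs.dvd_iff hw]
    have := Ideal.Quotient.isDomain (Ideal.span {a} ^ 1)
    exact mul_eq_zero.mp hxy

theorem exists_not_pow_dvd (hw : (w : RstarG R a) = aS R a) (x : CC R a taue)
    (hx : x ≠ 0) : ∃ n, ¬ w ^ n ∣ x := by
  by_contra! hall
  refine hx (Subtype.ext (AdicCompletion.ext_evalₐ fun n => ?_))
  obtain ⟨y, rfl⟩ := hall n
  rw [MulMemClass.coe_mul, SubmonoidClass.coe_pow, hw, map_mul, evalₐ_aS_pow, zero_mul,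
    ZeroMemClass.coe_zero, map_zero]

/-- `C[1/a]` is a localization of the polynomial ring `R[τ]`. -/
theorem SetupG.isLocalization (hs : SetupG R a cc tau taue)
    (hw : (w : RstarG R a) = aS R a) (L : Type) [CommRing L] [Algebra (CC R a taue) L]
    [IsLocalization.Away w L] :
    letI := ((algebraMap (CC R a taue) L).comp hs.evalCC.toRingHom).toAlgebra
    IsLocalization ((IsUnit.submonoid L).comap
      ((algebraMap (CC R a taue) L).comp hs.evalCC.toRingHom)) L := by
  let _ := ((algebraMap (CC R a taue) L).comp hs.evalCC.toRingHom).toAlgebra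
  have hwu : ∀ n, IsUnit (algebraMap (CC R a taue) L (w ^ n)) := fun n =>
    IsLocalization.map_units L (⟨w ^ n, n, rfl⟩ : Submonoid.powers w)
  have hinj : Function.Injective (algebraMap (CC R a taue) L) := IsLocalization.injective L
    (Submonoid.powers_le.mpr (hs.mem_nonZeroDivisors hw))
  refine ⟨fun y => y.2, fun z => ?_, fun {x y} hxy => ?_⟩
  · obtain ⟨⟨x, ⟨_, k, rfl⟩⟩, hx⟩ := IsLocalization.surj (Submonoid.powers w) z
    obtain ⟨p, s, d, hd, n, h1, h2⟩ := hs.CC_le_fracSubalgebra x.2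
    have h1' : x * hs.evalCC s = hs.evalCC p := Subtype.ext h1
    have h2' : (⟨d, hd⟩ : CC R a taue) * hs.evalCC s = w ^ n := by
      refine Subtype.ext (h2.trans ?_)
      rw [SubmonoidClass.coe_pow, hw]
    have h3 : hs.evalCC (MvPolynomial.C (a ^ k)) = w ^ k := by
      refine Subtype.ext ?_
      rw [SubmonoidClass.coe_pow, hw]
      change MvPolynomial.aeval tau _ = _
      rw [MvPolynomial.aeval_C, map_pow]; rfl
    have hsu : IsUnit (algebraMap (CC R a taue) L (hs.evalCC s)) := by
      refine isUnit_of_mul_isUnit_right (x := algebraMap (CC R a taue) L ⟨d, hd⟩) ?_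
      rw [← map_mul, h2']
      exact hwu n
    have hmem : IsUnit (algebraMap (CC R a taue) L (hs.evalCC (MvPolynomial.C (a ^ k) * s))) := by
      rw [map_mul, map_mul, h3]
      exact (hwu k).mul hsu
    refine ⟨⟨p, ⟨MvPolynomial.C (a ^ k) * s, hmem⟩⟩, ?_⟩
    change z * algebraMap (CC R a taue) L (hs.evalCC (MvPolynomial.C (a ^ k) * s)) =
      algebraMap (CC R a taue) L (hs.evalCC p)
    rw [map_mul, map_mul, h3, ← mul_assoc, hx, ← map_mul, h1']
  · exact ⟨1, by rw [hs.evalCC_injective (hinj hxy)]⟩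

end Main

theorem statement7 (R : Type) [CommRing R] [IsDomain R] [IsNoetherianRing R]
    [UniqueFactorizationMonoid R] (a : R) (hap : Prime a)
    {h : ℕ} (cc : Fin h → ℕ → R) (tau : Fin h → RstarG R a)
    (taue : Fin h → ℕ → RstarG R a) (hs : SetupG R a cc tau taue) :
    -- `aC` is a prime ideal of `C`
    (Ideal.span {w : ↥(CC R a taue) | (w : RstarG R a) = aS R a}).IsPrime ∧
    -- `C` is a unique factorization domain
    (∃ hd : IsDomain ↥(CC R a taue),
      haveI := hd
      UniqueFactorizationMonoid ↥(CC R a taue)) ∧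
    -- `C[1/a]` is a Noetherian unique factorization domain
    (∀ w : ↥(CC R a taue), (w : RstarG R a) = aS R a →
      ∀ (L : Type) [CommRing L] [Algebra ↥(CC R a taue) L], IsLocalization.Away w L →
        IsNoetherianRing L ∧
        (∃ hd : IsDomain L, haveI := hd; UniqueFactorizationMonoid L)) ∧
    -- if moreover `R` is regular, then `C[1/a]` is a regular Noetherian UFD
    (IsRegularRing R →
      ∀ w : ↥(CC R a taue), (w : RstarG R a) = aS R a →
        ∀ (L : Type) [CommRing L] [Algebra ↥(CC R a taue) L], IsLocalization.Away w L →
          IsRegularRing L) := by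
  have hdom : IsDomain ↥(CC R a taue) := by
    have hw : ((⟨aS R a, aS_mem _⟩ : CC R a taue) : RstarG R a) = aS R a := rfl
    exact isDomain_of_prime_of_separated (hs.prime hap hw) (hs.mem_nonZeroDivisors hw)
      (exists_not_pow_dvd hw)
  have haway : ∀ w : ↥(CC R a taue), (w : RstarG R a) = aS R a →
      ∀ (L : Type) [CommRing L] [Algebra ↥(CC R a taue) L], IsLocalization.Away w L →
        IsNoetherianRing L ∧ IsDomain L ∧ UniqueFactorizationMonoid L := by
    intro w hw L _ _ hL
    let _ := ((algebraMap (CC R a taue) L).comp hs.evalCC.toRingHom).toAlgebra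
    let M := (IsUnit.submonoid L).comap
      ((algebraMap (CC R a taue) L).comp hs.evalCC.toRingHom)
    have : IsLocalization M L := hs.isLocalization hw L
    exact ⟨IsLocalization.isNoetherianRing M L inferInstance,
      IsLocalization.isDomain_of_le_nonZeroDivisors L (M := Submonoid.powers w)
        (Submonoid.powers_le.mpr (hs.mem_nonZeroDivisors hw)),
      UniqueFactorizationMonoid.of_isLocalization M L⟩
  refine ⟨?_, ⟨hdom, ?_⟩, ?_, ?_⟩
  · have hset : {w : ↥(CC R a taue) | (w : RstarG R a) = aS R a} = {⟨aS R a, aS_mem _⟩} :=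
      Set.ext fun w => (Subtype.ext_iff (a2 := ⟨aS R a, aS_mem _⟩)).symm
    have hp : Prime (⟨aS R a, aS_mem _⟩ : CC R a taue) := hs.prime hap rfl
    rw [hset]
    exact (Ideal.span_singleton_prime hp.ne_zero).mpr hp
  · have hw : ((⟨aS R a, aS_mem _⟩ : CC R a taue) : RstarG R a) = aS R a := rfl
    obtain ⟨-, hd, hu⟩ := haway _ hw (Localization.Away (⟨aS R a, aS_mem _⟩ : CC R a taue))
      inferInstance
    exact uniqueFactorizationMonoid_of_away (hs.prime hap hw) (exists_not_pow_dvd hw)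
      (Localization.Away (⟨aS R a, aS_mem _⟩ : CC R a taue))
  · intro w hw L _ _ hL
    obtain ⟨h1, h2, h3⟩ := haway w hw L hL
    exact ⟨h1, h2, h3⟩
  · intro hR w hw L _ _ hL
    let _ := ((algebraMap (CC R a taue) L).comp hs.evalCC.toRingHom).toAlgebra
    let M := (IsUnit.submonoid L).comap
      ((algebraMap (CC R a taue) L).comp hs.evalCC.toRingHom)
    have : IsLocalization M L := hs.isLocalization hw L
    have := hR.toRegularRing
    exact isRegularRing_of_isLocalization M

end HRWGen
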